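/- Let α ∈ [1,2], p ∈ [1,∞], and let φ ∈ L^1(R^2) satisfy |x|φ ∈ L^1(R^2). Set M = ∫_{R^2} φ(x) dx. Then there exists C > 0 such that for all t > 0, ‖P_{α/2}(t)∗φ − M P_{α/2}(t)‖_{L^p} ≤ C ‖φ‖_{L^1(R^2; |x|dx)} t^{-(2/α)(1-1/p) - 1/α}. -/

import Mathlib

open MeasureTheory Real FourierTransform ENNReal

/-- The fractional heat kernel on `ℝ²`. -/
noncomputable def fracHeatKernel (α : ℝ) (t : ℝ) : EuclideanSpace ℝ (Fin 2) → ℂ :=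
  𝓕⁻ (fun ξ : EuclideanSpace ℝ (Fin 2) => (Real.exp (-t * ‖ξ‖ ^ α) : ℂ))

section Fourier

variable {V : Type*} [NormedAddCommGroup V] [InnerProductSpace ℝ V] [FiniteDimensional ℝ V]
  [MeasurableSpace V] [BorelSpace V]

theorem continuous_fourier_of_integrable {E : Type*} [NormedAddCommGroup E] [NormedSpace ℂ E]
    {f : V → E} (hf : Integrable f) : Continuous (𝓕 f) :=
  VectorFourier.fourierIntegral_continuous Real.continuous_fourierChar
    (innerSL ℝ).continuous₂ hf

/-- Plancherel's identity for functions in `L¹ ∩ L²`. -/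
theorem eLpNorm_fourier_eq {u : V → ℂ} (h1 : Integrable u) (h2 : MemLp u 2) :
    eLpNorm (𝓕 u) 2 volume = eLpNorm u 2 volume := by
  set U : Lp ℂ 2 (volume : Measure V) := h2.toLp u with hU
  have key : ((𝓕 U : Lp ℂ 2 (volume : Measure V)) : V → ℂ) =ᵐ[volume] 𝓕 u := by
    refine ae_eq_of_integral_contDiff_smul_eq (μ := volume)
      ((Lp.memLp (𝓕 U)).locallyIntegrable (by norm_num))
      (continuous_fourier_of_integrable h1).locallyIntegrable ?_
    · intro g g_smooth g_cpt
      have hg₁ : HasCompactSupport (Complex.ofRealCLM ∘ g) := g_cpt.comp_left rfl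
      have hg₂ : ContDiff ℝ ((⊤ : ℕ∞) : WithTop ℕ∞) (Complex.ofRealCLM ∘ g) := by fun_prop
      set ψ := hg₁.toSchwartzMap hg₂ with hψ
      have e1 : (Lp.toTemperedDistribution (𝓕 U) : TemperedDistribution V ℂ) ψ
          = Lp.toTemperedDistribution U (𝓕 ψ) := by
        rw [← Lp.fourier_toTemperedDistribution_eq]; rfl
      rw [Lp.toTemperedDistribution_apply, Lp.toTemperedDistribution_apply] at e1
      have e2 : ∫ x, (𝓕 ψ) x • U x = ∫ x, (𝓕 ψ) x • u x := by
        apply integral_congr_ae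
        filter_upwards [h2.coeFn_toLp] with x hx
        rw [hU, hx]
      have e3 : ∫ x, (𝓕 ψ) x • u x = ∫ x, ψ x • 𝓕 u x := by
        simpa using! VectorFourier.integral_bilin_fourierIntegral_eq_flip
          (ContinuousLinearMap.lsmul ℂ ℂ) (L := innerₗ V)
          continuous_fourierChar continuous_inner ψ.integrable h1
      have e4 := e1.trans (e2.trans e3)
      simpa [hψ] using e4
  rw [← eLpNorm_congr_ae key, ← eLpNorm_congr_ae h2.coeFn_toLp, ← Lp.enorm_def, ← Lp.enorm_def,
    ← ofReal_norm, ← ofReal_norm, Lp.norm_fourier_eq]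

/-- The Fourier transform turns a line derivative into a multiplication. -/
theorem fourier_lineDeriv {g g' : V → ℂ} {e : V} (hg : Integrable g) (hg' : Integrable g')
    (h : ∀ x, HasLineDerivAt ℝ g (g' x) x e) (w : V) :
    𝓕 g' w = (2 * π * Complex.I * (inner ℝ e w : ℝ)) * 𝓕 g w := by
  have hc (x : V) : HasLineDerivAt ℝ (fun v : V => ((Real.fourierChar (-inner ℝ v w) : Circle) : ℂ))
      (-(2 * π * Complex.I * (inner ℝ e w : ℝ)) *
        ((Real.fourierChar (-inner ℝ x w) : Circle) : ℂ)) x e := by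
    let L : V →L[ℝ] V →L[ℝ] ℝ := innerSL ℝ
    have hL (a b : V) : L a b = inner ℝ a b := rfl
    have := (hasFDerivAt_fourierChar_neg_bilinear_left L x w).hasLineDerivAt e
    convert! this using 1
    simp only [smul_apply, ContinuousLinearMap.comp_apply, ContinuousLinearMap.flip_apply,
      hL, Complex.ofRealCLM_apply, smul_eq_mul]
    ring
  have := integral_bilinear_hasLineDerivAt_right_eq_neg_left_of_integrable
    (μ := (volume : Measure V)) (B := ContinuousLinearMap.mul ℝ ℂ)
    (f := fun v : V => ((Real.fourierChar (-inner ℝ v w) : Circle) : ℂ)) (g := g) (g' := g')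
    (v := e)
    (f' := fun x => -(2 * π * Complex.I * (inner ℝ e w : ℝ)) *
        ((Real.fourierChar (-inner ℝ x w) : Circle) : ℂ))
    (by
      have := ((Real.fourierIntegral_convergent_iff w).2 hg).const_mul
        (-(2 * π * Complex.I * (inner ℝ e w : ℝ)))
      simpa [Circle.smul_def, mul_assoc] using this)
    (by simpa [Circle.smul_def] using (Real.fourierIntegral_convergent_iff w).2 hg')
    (by simpa [Circle.smul_def] using (Real.fourierIntegral_convergent_iff w).2 hg)
    (fun x _ => hc x) (fun x _ => h x)
  simp only [ContinuousLinearMap.mul_apply', mul_assoc, integral_const_mul, neg_mul,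
    integral_neg, neg_neg] at this
  simp only [Real.fourier_eq, Circle.smul_def, smul_eq_mul]
  rw [this]
  ring_nf

end Fourier

section Symbol

variable {V : Type*} [NormedAddCommGroup V] [InnerProductSpace ℝ V]

/-- The regularised symbol `⟪v, ξ⟫ exp (-(ε + ‖ξ‖²) ^ a)`. -/
noncomputable def regSymbol (a ε : ℝ) (v ξ : V) : ℝ :=
  inner ℝ v ξ * Real.exp (-(ε + ‖ξ‖ ^ 2) ^ a)

/-- The derivative of `(ε + ‖ξ‖²) ^ a` in the direction `e`. -/
noncomputable def regPowDeriv (a ε : ℝ) (e ξ : V) : ℝ :=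
  2 * a * inner ℝ ξ e * (ε + ‖ξ‖ ^ 2) ^ (a - 1)

/-- The second derivative of `(ε + ‖ξ‖²) ^ a` in the direction `e`. -/
noncomputable def regPowDeriv₂ (a ε : ℝ) (e ξ : V) : ℝ :=
  2 * a * ‖e‖ ^ 2 * (ε + ‖ξ‖ ^ 2) ^ (a - 1) +
    4 * a * (a - 1) * inner ℝ ξ e ^ 2 * (ε + ‖ξ‖ ^ 2) ^ (a - 2)

/-- The derivative of `regSymbol a ε v` in the direction `e`. -/
noncomputable def regSymbolDeriv (a ε : ℝ) (v e ξ : V) : ℝ :=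
  (inner ℝ v e - inner ℝ v ξ * regPowDeriv a ε e ξ) * Real.exp (-(ε + ‖ξ‖ ^ 2) ^ a)

/-- The second derivative of `regSymbol a ε v` in the direction `e`. -/
noncomputable def regSymbolDeriv₂ (a ε : ℝ) (v e ξ : V) : ℝ :=
  (-2 * inner ℝ v e * regPowDeriv a ε e ξ - inner ℝ v ξ * regPowDeriv₂ a ε e ξ +
    inner ℝ v ξ * regPowDeriv a ε e ξ ^ 2) * Real.exp (-(ε + ‖ξ‖ ^ 2) ^ a)

theorem hasLineDerivAt_inner_left (v ξ e : V) :
    HasLineDerivAt ℝ (fun x : V => (inner ℝ v x : ℝ)) (inner ℝ v e) ξ e :=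
  (innerSL ℝ v).hasFDerivAt.hasLineDerivAt e

theorem hasLineDerivAt_add_norm_sq (ε : ℝ) (ξ e : V) :
    HasLineDerivAt ℝ (fun x : V => ε + ‖x‖ ^ 2) (2 * inner ℝ ξ e) ξ e := by
  have := ((hasStrictFDerivAt_norm_sq ξ).hasFDerivAt.const_add ε).hasLineDerivAt e
  simpa using this

theorem hasLineDerivAt_regPow {ε : ℝ} (hε : 0 < ε) (a : ℝ) (ξ e : V) :
    HasLineDerivAt ℝ (fun x : V => (ε + ‖x‖ ^ 2) ^ a) (regPowDeriv a ε e ξ) ξ e := by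
  have h0 : 0 < ε + ‖ξ‖ ^ 2 := by positivity
  have := HasDerivAt.rpow_const (p := a) (hasLineDerivAt_add_norm_sq ε ξ e)
    (Or.inl (by simpa using h0.ne'))
  refine HasDerivAt.congr_deriv this ?_
  simp only [regPowDeriv, zero_smul, add_zero]
  ring

theorem hasLineDerivAt_regPowDeriv {ε : ℝ} (hε : 0 < ε) (a : ℝ) (ξ e : V) :
    HasLineDerivAt ℝ (regPowDeriv a ε e) (regPowDeriv₂ a ε e ξ) ξ e := by
  have h1 : HasLineDerivAt ℝ (fun x : V => (inner ℝ x e : ℝ)) (inner ℝ e e) ξ e := by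
    simpa only [real_inner_comm] using hasLineDerivAt_inner_left e ξ e
  have := (HasDerivAt.const_mul (2 * a) h1).mul (hasLineDerivAt_regPow hε (a - 1) ξ e)
  refine HasDerivAt.congr_deriv this ?_
  simp only [regPowDeriv, regPowDeriv₂, zero_smul, add_zero, real_inner_self_eq_norm_sq]
  rw [show a - 1 - 1 = a - 2 by ring]
  ring

theorem hasLineDerivAt_exp_regPow {ε : ℝ} (hε : 0 < ε) (a : ℝ) (ξ e : V) :
    HasLineDerivAt ℝ (fun x : V => Real.exp (-(ε + ‖x‖ ^ 2) ^ a))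
      (-regPowDeriv a ε e ξ * Real.exp (-(ε + ‖ξ‖ ^ 2) ^ a)) ξ e := by
  have := HasDerivAt.exp (HasDerivAt.neg (hasLineDerivAt_regPow hε a ξ e))
  refine HasDerivAt.congr_deriv this ?_
  simp
  ring

theorem hasLineDerivAt_regSymbol {ε : ℝ} (hε : 0 < ε) (a : ℝ) (v ξ e : V) :
    HasLineDerivAt ℝ (regSymbol a ε v) (regSymbolDeriv a ε v e ξ) ξ e := by
  have := HasDerivAt.mul (hasLineDerivAt_inner_left v ξ e) (hasLineDerivAt_exp_regPow hε a ξ e)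
  refine HasDerivAt.congr_deriv this ?_
  simp only [regSymbolDeriv, zero_smul, add_zero]
  ring

theorem hasLineDerivAt_regSymbolDeriv {ε : ℝ} (hε : 0 < ε) (a : ℝ) (v ξ e : V) :
    HasLineDerivAt ℝ (regSymbolDeriv a ε v e) (regSymbolDeriv₂ a ε v e ξ) ξ e := by
  have := HasDerivAt.mul (HasDerivAt.const_sub (inner ℝ v e)
    (HasDerivAt.mul (hasLineDerivAt_inner_left v ξ e) (hasLineDerivAt_regPowDeriv hε a ξ e)))
    (hasLineDerivAt_exp_regPow hε a ξ e)
  refine HasDerivAt.congr_deriv this ?_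
  simp only [regSymbolDeriv₂, Pi.mul_apply, zero_smul, add_zero]
  ring

theorem HasLineDerivAt.ofReal_comp {f : V → ℝ} {f' : ℝ} {x e : V}
    (h : HasLineDerivAt ℝ f f' x e) : HasLineDerivAt ℝ (fun x => (f x : ℂ)) (f' : ℂ) x e :=
  HasDerivAt.ofReal_comp h

theorem one_add_pow_mul_exp_neg_rpow_le {a r : ℝ} (ha : 1 / 2 ≤ a) (hr : 0 ≤ r) :
    (1 + r) ^ 5 * Real.exp (-r ^ a) ≤ (Nat.factorial 10) * Real.exp 2 := by
  have h1 : √r ≤ 1 + r ^ a := by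
    rcases le_total r 1 with h | h
    · have : √r ≤ 1 := Real.sqrt_le_one.2 h
      have := Real.rpow_nonneg hr a
      linarith
    · rw [Real.sqrt_eq_rpow]
      have := Real.rpow_le_rpow_of_exponent_le h ha
      linarith
  have hs := Real.sqrt_nonneg r
  have h2 : 1 + r ≤ (1 + √r) ^ 2 := by nlinarith [Real.sq_sqrt hr]
  have h3 : (1 + √r) ^ 10 ≤ (Nat.factorial 10) * Real.exp (1 + √r) := by
    have := Real.pow_div_factorial_le_exp (1 + √r) (by positivity) 10
    rwa [div_le_iff₀ (by positivity), mul_comm] at this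
  calc (1 + r) ^ 5 * Real.exp (-r ^ a)
      ≤ ((1 + √r) ^ 2) ^ 5 * Real.exp (1 - √r) := by gcongr; linarith
    _ = (1 + √r) ^ 10 * Real.exp (1 - √r) := by ring
    _ ≤ ((Nat.factorial 10) * Real.exp (1 + √r)) * Real.exp (1 - √r) := by gcongr
    _ = _ := by rw [mul_assoc, ← Real.exp_add]; ring_nf

theorem exists_bound_mul_exp_neg_rpow {E : Type*} [NormedAddCommGroup E] {a : ℝ}
    (ha : 1 / 2 ≤ a) :
    ∃ K : ℝ, 0 < K ∧ ∀ ε : ℝ, 0 ≤ ε → ∀ (ξ : E) (b : ℝ), |b| ≤ 14 * (1 + (ε + ‖ξ‖ ^ 2)) ^ 3 →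
      |b * Real.exp (-(ε + ‖ξ‖ ^ 2) ^ a)| ≤ K * ((1 + ‖ξ‖ ^ 2) ^ 2)⁻¹ := by
  refine ⟨14 * ((Nat.factorial 10) * Real.exp 2), by positivity, fun ε hε ξ b hb => ?_⟩
  set r := ε + ‖ξ‖ ^ 2 with hr
  have hr0 : 0 ≤ r := by positivity
  have h1 := one_add_pow_mul_exp_neg_rpow_le ha hr0
  have h2 : (1 + ‖ξ‖ ^ 2) ^ 2 ≤ (1 + r) ^ 2 := by gcongr; linarith
  rw [← div_eq_mul_inv, le_div_iff₀ (by positivity), abs_mul, Real.abs_exp]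
  calc |b| * Real.exp (-r ^ a) * (1 + ‖ξ‖ ^ 2) ^ 2
      ≤ (14 * (1 + r) ^ 3) * Real.exp (-r ^ a) * (1 + r) ^ 2 := by gcongr
    _ = 14 * ((1 + r) ^ 5 * Real.exp (-r ^ a)) := by ring
    _ ≤ _ := by gcongr

theorem abs_inner_le_sqrt {ε : ℝ} (hε : 0 ≤ ε) {v : V} (hv : ‖v‖ = 1) (ξ : V) :
    |inner ℝ v ξ| ≤ √(ε + ‖ξ‖ ^ 2) := by
  refine (abs_real_inner_le_norm v ξ).trans ?_
  rw [hv, one_mul]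
  exact Real.le_sqrt_of_sq_le (by linarith)

theorem sqrt_le_one_add {r : ℝ} (hr : 0 ≤ r) : √r ≤ 1 + r := by
  rw [Real.sqrt_le_left (by positivity)]
  nlinarith

theorem sqrt_mul_rpow_le {a r : ℝ} (ha : 1 / 2 ≤ a) (ha' : a ≤ 1) (hr : 0 < r) :
    √r * r ^ (a - 1) ≤ 1 + r := by
  rw [Real.sqrt_eq_rpow, ← Real.rpow_add hr]
  calc r ^ (1 / 2 + (a - 1)) ≤ (1 + r) ^ (1 / 2 + (a - 1)) :=
        Real.rpow_le_rpow hr.le (by linarith) (by linarith)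
    _ ≤ (1 + r) ^ (1 : ℝ) := Real.rpow_le_rpow_of_exponent_le (by linarith) (by linarith)
    _ = 1 + r := Real.rpow_one _

theorem abs_regPowDeriv_le {a ε : ℝ} (ha : 1 / 2 ≤ a) (ha' : a ≤ 1) (hε : 0 < ε) {e : V}
    (he : ‖e‖ = 1) (ξ : V) :
    |regPowDeriv a ε e ξ| ≤ 2 * (1 + (ε + ‖ξ‖ ^ 2)) := by
  have hi : |inner ℝ ξ e| ≤ √(ε + ‖ξ‖ ^ 2) := by
    rw [real_inner_comm]; exact abs_inner_le_sqrt hε.le he ξ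
  unfold regPowDeriv
  set r := ε + ‖ξ‖ ^ 2 with hr
  have hr0 : 0 < r := by positivity
  have h2 := sqrt_mul_rpow_le ha ha' hr0
  rw [abs_mul, abs_mul, abs_of_nonneg (by linarith : 0 ≤ 2 * a),
    abs_of_nonneg (Real.rpow_nonneg hr0.le _)]
  calc 2 * a * |inner ℝ ξ e| * r ^ (a - 1) ≤ 2 * 1 * √r * r ^ (a - 1) := by gcongr
    _ = 2 * (√r * r ^ (a - 1)) := by ring
    _ ≤ _ := by gcongr

theorem abs_inner_mul_regPowDeriv₂_le {a ε : ℝ} (ha : 1 / 2 ≤ a) (ha' : a ≤ 1) (hε : 0 < ε)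
    {v e : V} (hv : ‖v‖ = 1) (he : ‖e‖ = 1) (ξ : V) :
    |inner ℝ v ξ * regPowDeriv₂ a ε e ξ| ≤ 6 * (1 + (ε + ‖ξ‖ ^ 2)) := by
  have hi : |inner ℝ ξ e| ≤ √(ε + ‖ξ‖ ^ 2) := by
    rw [real_inner_comm]; exact abs_inner_le_sqrt hε.le he ξ
  have hj := abs_inner_le_sqrt hε.le hv ξ
  unfold regPowDeriv₂
  rw [he]
  set r := ε + ‖ξ‖ ^ 2 with hr
  have hr0 : 0 < r := by positivity
  have h2 := sqrt_mul_rpow_le ha ha' hr0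
  have h3 : inner ℝ ξ e ^ 2 ≤ r := by
    rw [← sq_abs]
    exact (pow_le_pow_left₀ (abs_nonneg _) hi 2).trans (Real.sq_sqrt hr0.le).le
  have h4 : r * r ^ (a - 2) = r ^ (a - 1) := by
    rw [show a - 1 = 1 + (a - 2) by ring, Real.rpow_add hr0, Real.rpow_one]
  have h5 : |2 * a * 1 ^ 2 * r ^ (a - 1) + 4 * a * (a - 1) * inner ℝ ξ e ^ 2 * r ^ (a - 2)|
      ≤ 6 * r ^ (a - 1) := by
    have p1 := Real.rpow_nonneg hr0.le (a - 1)
    have p2 := Real.rpow_nonneg hr0.le (a - 2)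
    have q : inner ℝ ξ e ^ 2 * r ^ (a - 2) ≤ r ^ (a - 1) := by rw [← h4]; gcongr
    have q0 : 0 ≤ inner ℝ ξ e ^ 2 * r ^ (a - 2) := by positivity
    have c : |4 * a * (a - 1)| ≤ 4 := by rw [abs_le]; constructor <;> nlinarith
    refine (abs_add_le _ _).trans ?_
    rw [mul_assoc (4 * a * (a - 1)), abs_mul (4 * a * (a - 1)), abs_of_nonneg q0,
      abs_of_nonneg (by positivity)]
    nlinarith [mul_le_mul c q q0 (by norm_num : (0 : ℝ) ≤ 4)]
  rw [abs_mul]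
  calc _ ≤ √r * (6 * r ^ (a - 1)) := by gcongr
    _ = 6 * (√r * r ^ (a - 1)) := by ring
    _ ≤ _ := by gcongr

/-- The regularised symbol and its first two derivatives decay uniformly in `ε`. -/
theorem exists_bound_regSymbol {a : ℝ} (ha : 1 / 2 ≤ a) (ha' : a ≤ 1) :
    ∃ K : ℝ, 0 < K ∧ ∀ ε : ℝ, 0 < ε → ∀ v e : V, ‖v‖ = 1 → ‖e‖ = 1 → ∀ ξ : V,
      |regSymbol a ε v ξ| ≤ K * ((1 + ‖ξ‖ ^ 2) ^ 2)⁻¹ ∧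
      |regSymbolDeriv a ε v e ξ| ≤ K * ((1 + ‖ξ‖ ^ 2) ^ 2)⁻¹ ∧
      |regSymbolDeriv₂ a ε v e ξ| ≤ K * ((1 + ‖ξ‖ ^ 2) ^ 2)⁻¹ := by
  obtain ⟨K, hK, h⟩ := exists_bound_mul_exp_neg_rpow (E := V) ha
  refine ⟨K, hK, fun ε hε v e hv he ξ => ?_⟩
  have hj := (abs_inner_le_sqrt hε.le hv ξ).trans (sqrt_le_one_add (by positivity))
  have hw1 := abs_regPowDeriv_le ha ha' hε he ξ
  have hw2 := abs_inner_mul_regPowDeriv₂_le ha ha' hε hv he ξ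
  have hve : |inner ℝ v e| ≤ 1 := by simpa [hv, he] using abs_real_inner_le_norm v e
  have hρ : 1 ≤ 1 + (ε + ‖ξ‖ ^ 2) := by
    have : 0 ≤ ε + ‖ξ‖ ^ 2 := by positivity
    linarith
  refine ⟨h ε hε.le ξ _ ?_, h ε hε.le ξ _ ?_, h ε hε.le ξ _ ?_⟩
  all_goals
    set ρ := 1 + (ε + ‖ξ‖ ^ 2)
    have hρ2 : ρ ≤ ρ ^ 2 := by nlinarith
    have hρ3 : ρ ^ 2 ≤ ρ ^ 3 := by nlinarith
  · linarith
  · have := mul_le_mul hj hw1 (abs_nonneg _) (by linarith)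
    rw [← abs_mul] at this
    refine (abs_sub _ _).trans ?_
    nlinarith
  · have t1 := mul_le_mul hve hw1 (abs_nonneg _) zero_le_one
    have t2 := mul_le_mul hj (pow_le_pow_left₀ (abs_nonneg _) hw1 2) (by positivity) (by linarith)
    rw [← abs_pow, ← abs_mul] at t2
    rw [← abs_mul] at t1
    have t3 : |-2 * inner ℝ v e * regPowDeriv a ε e ξ| =
        2 * |inner ℝ v e * regPowDeriv a ε e ξ| := by
      rw [mul_assoc, abs_mul]; norm_num
    refine (abs_add_le _ _).trans ((add_le_add_left (abs_sub _ _) _).trans ?_)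
    rw [t3]
    nlinarith

end Symbol

section Gradient

local notation "ℝ²" => EuclideanSpace ℝ (Fin 2)

theorem integrable_inv_one_add_norm_sq_sq : Integrable (fun ξ : ℝ² => ((1 + ‖ξ‖ ^ 2) ^ 2)⁻¹) := by
  have := integrable_rpow_neg_one_add_norm_sq (E := ℝ²) (μ := volume) (r := 4) (by simp; norm_num)
  refine this.congr (Filter.Eventually.of_forall fun ξ => ?_)
  simp only
  rw [show (-4 / 2 : ℝ) = -((2 : ℕ) : ℝ) by norm_num, Real.rpow_neg (by positivity),
    Real.rpow_natCast]

theorem measurable_regSymbol (a ε : ℝ) (v : ℝ²) : Measurable (regSymbol a ε v) := by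
  unfold regSymbol
  have : Measurable fun ξ : ℝ² => (inner ℝ v ξ : ℝ) := by fun_prop
  fun_prop

theorem measurable_regPowDeriv (a ε : ℝ) (e : ℝ²) : Measurable (regPowDeriv a ε e) := by
  unfold regPowDeriv
  have : Measurable fun ξ : ℝ² => (inner ℝ ξ e : ℝ) := by fun_prop
  fun_prop

theorem measurable_regPowDeriv₂ (a ε : ℝ) (e : ℝ²) : Measurable (regPowDeriv₂ a ε e) := by
  unfold regPowDeriv₂
  have : Measurable fun ξ : ℝ² => (inner ℝ ξ e : ℝ) := by fun_prop
  fun_prop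

theorem measurable_regSymbolDeriv (a ε : ℝ) (v e : ℝ²) :
    Measurable (regSymbolDeriv a ε v e) := by
  unfold regSymbolDeriv
  have := measurable_regPowDeriv a ε e
  have : Measurable fun ξ : ℝ² => (inner ℝ v ξ : ℝ) := by fun_prop
  fun_prop

theorem measurable_regSymbolDeriv₂ (a ε : ℝ) (v e : ℝ²) :
    Measurable (regSymbolDeriv₂ a ε v e) := by
  unfold regSymbolDeriv₂
  have := measurable_regPowDeriv a ε e
  have := measurable_regPowDeriv₂ a ε e
  have : Measurable fun ξ : ℝ² => (inner ℝ v ξ : ℝ) := by fun_prop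
  fun_prop

theorem integrable_ofReal_of_bound {g : ℝ² → ℝ} {K : ℝ} (hg : Measurable g)
    (h : ∀ ξ, |g ξ| ≤ K * ((1 + ‖ξ‖ ^ 2) ^ 2)⁻¹) : Integrable (fun ξ => (g ξ : ℂ)) :=
  (Integrable.mono' (integrable_inv_one_add_norm_sq_sq.const_mul K) hg.aestronglyMeasurable
    (Filter.Eventually.of_forall h)).ofReal

theorem lintegral_enorm_sq_eq {X : Type*} [MeasurableSpace X] {μ : Measure X} (f : X → ℂ) :
    ∫⁻ x, ‖f x‖ₑ ^ 2 ∂μ = eLpNorm f 2 μ ^ 2 := by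
  have := eLpNorm_nnreal_pow_eq_lintegral (μ := μ) (f := f) (p := 2) two_ne_zero
  simpa using this.symm

/-- An `L¹` bound for a Fourier transform controlled by `(1 + ‖x‖²)⁻¹ 𝓕 u` with `u ∈ L²`. -/
theorem lintegral_fourier_le_of_mul_one_add {u : ℝ² → ℝ} {f : ℝ² → ℂ} {K : ℝ}
    (hu : Measurable u) (hb : ∀ ξ, |u ξ| ≤ K * ((1 + ‖ξ‖ ^ 2) ^ 2)⁻¹)
    (hf : ∀ x, (1 + ‖x‖ ^ 2) * ‖f x‖ ≤ ‖𝓕 (fun ξ => (u ξ : ℂ)) x‖) :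
    ∫⁻ x, ‖f x‖ₑ ≤ ENNReal.ofReal ((1 + K ^ 2) * ∫ ξ : ℝ², ((1 + ‖ξ‖ ^ 2) ^ 2)⁻¹) := by
  have h1 := integrable_ofReal_of_bound hu hb
  have hsq (ξ : ℝ²) : u ξ ^ 2 ≤ K ^ 2 * ((1 + ‖ξ‖ ^ 2) ^ 2)⁻¹ := by
    have hw : ((1 + ‖ξ‖ ^ 2) ^ 2)⁻¹ ≤ 1 := inv_le_one_of_one_le₀ (by nlinarith [sq_nonneg ‖ξ‖])
    have hw0 : 0 ≤ ((1 + ‖ξ‖ ^ 2) ^ 2)⁻¹ := by positivity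
    calc u ξ ^ 2 = |u ξ| ^ 2 := (sq_abs _).symm
      _ ≤ (K * ((1 + ‖ξ‖ ^ 2) ^ 2)⁻¹) ^ 2 := by gcongr; exact hb ξ
      _ = K ^ 2 * (((1 + ‖ξ‖ ^ 2) ^ 2)⁻¹ * ((1 + ‖ξ‖ ^ 2) ^ 2)⁻¹) := by ring
      _ ≤ K ^ 2 * (((1 + ‖ξ‖ ^ 2) ^ 2)⁻¹ * 1) := by gcongr
      _ = _ := by ring
  have hint2 : Integrable (fun ξ => ‖(u ξ : ℂ)‖ ^ 2) := by
    refine Integrable.mono' (integrable_inv_one_add_norm_sq_sq.const_mul (K ^ 2))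
      (by fun_prop) (Filter.Eventually.of_forall fun ξ => ?_)
    simpa using hsq ξ
  have h2 : MemLp (fun ξ => (u ξ : ℂ)) 2 :=
    (memLp_two_iff_integrable_sq_norm h1.aestronglyMeasurable).2 hint2
  have hplan : ∫⁻ x, ‖𝓕 (fun ξ => (u ξ : ℂ)) x‖ₑ ^ 2
      ≤ ∫⁻ ξ : ℝ², ENNReal.ofReal (K ^ 2 * ((1 + ‖ξ‖ ^ 2) ^ 2)⁻¹) := by
    rw [lintegral_enorm_sq_eq, eLpNorm_fourier_eq h1 h2, ← lintegral_enorm_sq_eq]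
    refine lintegral_mono fun ξ => ?_
    rw [← ofReal_norm, ← ENNReal.ofReal_pow (norm_nonneg _)]
    exact ENNReal.ofReal_le_ofReal (by simpa using hsq ξ)
  have hpt (x : ℝ²) : ‖f x‖ₑ ≤ ENNReal.ofReal ((1 + ‖x‖ ^ 2) ^ 2)⁻¹ +
      ‖𝓕 (fun ξ => (u ξ : ℂ)) x‖ₑ ^ 2 := by
    rw [← ofReal_norm, ← ofReal_norm, ← ENNReal.ofReal_pow (norm_nonneg _),
      ← ENNReal.ofReal_add (by positivity) (by positivity)]
    apply ENNReal.ofReal_le_ofReal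
    set y := ‖𝓕 (fun ξ => (u ξ : ℂ)) x‖
    have hp : 0 < 1 + ‖x‖ ^ 2 := by positivity
    have : ‖f x‖ ≤ (1 + ‖x‖ ^ 2)⁻¹ * y := by
      rw [inv_mul_eq_div, le_div_iff₀ hp, mul_comm]; exact hf x
    rw [← inv_pow]
    nlinarith [sq_nonneg ((1 + ‖x‖ ^ 2)⁻¹ - y), sq_nonneg ((1 + ‖x‖ ^ 2)⁻¹), sq_nonneg y]
  calc ∫⁻ x, ‖f x‖ₑ ≤ ∫⁻ x : ℝ², (ENNReal.ofReal ((1 + ‖x‖ ^ 2) ^ 2)⁻¹ +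
        ‖𝓕 (fun ξ => (u ξ : ℂ)) x‖ₑ ^ 2) := lintegral_mono hpt
    _ = (∫⁻ x : ℝ², ENNReal.ofReal ((1 + ‖x‖ ^ 2) ^ 2)⁻¹) +
        ∫⁻ x, ‖𝓕 (fun ξ => (u ξ : ℂ)) x‖ₑ ^ 2 := lintegral_add_left (by fun_prop) _
    _ ≤ (∫⁻ x : ℝ², ENNReal.ofReal ((1 + ‖x‖ ^ 2) ^ 2)⁻¹) +
        ∫⁻ ξ : ℝ², ENNReal.ofReal (K ^ 2 * ((1 + ‖ξ‖ ^ 2) ^ 2)⁻¹) := by gcongr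
    _ = _ := by
      rw [← ofReal_integral_eq_lintegral_ofReal integrable_inv_one_add_norm_sq_sq
          (Filter.Eventually.of_forall fun ξ => by positivity),
        ← ofReal_integral_eq_lintegral_ofReal (integrable_inv_one_add_norm_sq_sq.const_mul _)
          (Filter.Eventually.of_forall fun ξ => by positivity), integral_const_mul,
        ← ENNReal.ofReal_add (integral_nonneg fun ξ => by positivity)
          (mul_nonneg (by positivity) (integral_nonneg fun ξ => by positivity))]
      congr 1
      ring

theorem exists_lintegral_fourier_regSymbol_le {a : ℝ} (ha : 1 / 2 ≤ a) (ha' : a ≤ 1) :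
    ∃ B : ℝ, ∀ ε : ℝ, 0 < ε → ∀ v : ℝ², ‖v‖ = 1 →
      ∫⁻ x, ‖𝓕 (fun ξ : ℝ² => (regSymbol a ε v ξ : ℂ)) x‖ₑ ≤ ENNReal.ofReal B := by
  obtain ⟨K, hK, h⟩ := exists_bound_regSymbol (V := ℝ²) ha ha'
  refine ⟨_, fun ε hε v hv => lintegral_fourier_le_of_mul_one_add (K := 3 * K)
    (u := fun ξ => regSymbol a ε v ξ - (regSymbolDeriv₂ a ε v (EuclideanSpace.single 0 1) ξ +
      regSymbolDeriv₂ a ε v (EuclideanSpace.single 1 1) ξ)) ?_ ?_ ?_⟩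
  · exact (measurable_regSymbol a ε v).sub ((measurable_regSymbolDeriv₂ a ε v _).add
      (measurable_regSymbolDeriv₂ a ε v _))
  · intro ξ
    have h0 := h ε hε v (EuclideanSpace.single 0 1) hv (by simp) ξ
    have h1 := h ε hε v (EuclideanSpace.single 1 1) hv (by simp) ξ
    refine (abs_sub _ _).trans ((add_le_add_right (abs_add_le _ _) _).trans ?_)
    linarith [h0.1, h0.2.2, h1.2.2]
  · intro x
    have hg : Integrable (fun ξ : ℝ² => (regSymbol a ε v ξ : ℂ)) :=
      integrable_ofReal_of_bound (measurable_regSymbol a ε v) fun ξ => (h ε hε v v hv hv ξ).1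
    have hd {e : ℝ²} (he : ‖e‖ = 1) : Integrable (fun ξ : ℝ² => (regSymbolDeriv a ε v e ξ : ℂ)) :=
      integrable_ofReal_of_bound (measurable_regSymbolDeriv a ε v e)
        fun ξ => (h ε hε v e hv he ξ).2.1
    have hdd {e : ℝ²} (he : ‖e‖ = 1) :
        Integrable (fun ξ : ℝ² => (regSymbolDeriv₂ a ε v e ξ : ℂ)) :=
      integrable_ofReal_of_bound (measurable_regSymbolDeriv₂ a ε v e)
        fun ξ => (h ε hε v e hv he ξ).2.2
    have hF {e : ℝ²} (he : ‖e‖ = 1) : 𝓕 (fun ξ : ℝ² => (regSymbolDeriv₂ a ε v e ξ : ℂ)) x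
        = -((2 * π * inner ℝ e x) ^ 2 : ℝ) * 𝓕 (fun ξ : ℝ² => (regSymbol a ε v ξ : ℂ)) x := by
      rw [fourier_lineDeriv (hd he) (hdd he)
          (fun ξ => (hasLineDerivAt_regSymbolDeriv hε a v ξ e).ofReal_comp),
        fourier_lineDeriv hg (hd he)
          (fun ξ => (hasLineDerivAt_regSymbol hε a v ξ e).ofReal_comp)]
      push_cast
      linear_combination (4 * π ^ 2 * (inner ℝ e x : ℝ) ^ 2 *
        𝓕 (fun ξ : ℝ² => (regSymbol a ε v ξ : ℂ)) x) * Complex.I_sq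
    have he0 : ‖(EuclideanSpace.single 0 1 : ℝ²)‖ = 1 := by simp
    have he1 : ‖(EuclideanSpace.single 1 1 : ℝ²)‖ = 1 := by simp
    have hsum : 𝓕 (fun ξ : ℝ² => ((regSymbol a ε v ξ -
        (regSymbolDeriv₂ a ε v (EuclideanSpace.single 0 1) ξ +
          regSymbolDeriv₂ a ε v (EuclideanSpace.single 1 1) ξ) : ℝ) : ℂ)) x
        = ((1 + (2 * π) ^ 2 * ‖x‖ ^ 2 : ℝ) : ℂ) *
          𝓕 (fun ξ : ℝ² => (regSymbol a ε v ξ : ℂ)) x := by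
      have := (Real.fourierIntegral_convergent_iff x).2 hg
      have h0 := (Real.fourierIntegral_convergent_iff x).2 (hdd he0)
      have h1 := (Real.fourierIntegral_convergent_iff x).2 (hdd he1)
      have e1 : 𝓕 (fun ξ : ℝ² => ((regSymbol a ε v ξ -
        (regSymbolDeriv₂ a ε v (EuclideanSpace.single 0 1) ξ +
          regSymbolDeriv₂ a ε v (EuclideanSpace.single 1 1) ξ) : ℝ) : ℂ)) x =
          𝓕 (fun ξ : ℝ² => (regSymbol a ε v ξ : ℂ)) x -
          (𝓕 (fun ξ : ℝ² => (regSymbolDeriv₂ a ε v (EuclideanSpace.single 0 1) ξ : ℂ)) x +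
          𝓕 (fun ξ : ℝ² => (regSymbolDeriv₂ a ε v (EuclideanSpace.single 1 1) ξ : ℂ)) x) := by
        simp only [Real.fourier_eq]
        rw [← integral_add h0 h1]
        refine Eq.trans ?_ (integral_sub this (h0.add h1))
        simp [smul_sub, smul_add]
      rw [e1, hF he0, hF he1, EuclideanSpace.norm_sq_eq]
      simp [Fin.sum_univ_two, EuclideanSpace.inner_single_left]
      ring
    rw [hsum, norm_mul, Complex.norm_real, Real.norm_of_nonneg (by positivity)]
    gcongr
    have : 1 ≤ (2 * π) ^ 2 := by nlinarith [Real.two_le_pi]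
    nlinarith [sq_nonneg ‖x‖]

theorem exists_lintegral_fourier_symbol_le {α : ℝ} (hα₁ : 1 ≤ α) (hα₂ : α ≤ 2) :
    ∃ B : ℝ, ∀ v : ℝ², ‖v‖ = 1 →
      ∫⁻ x, ‖𝓕 (fun ξ : ℝ² => ((inner ℝ v ξ * Real.exp (-‖ξ‖ ^ α) : ℝ) : ℂ)) x‖ₑ
        ≤ ENNReal.ofReal B := by
  have ha : 1 / 2 ≤ α / 2 := by linarith
  have ha' : α / 2 ≤ 1 := by linarith
  obtain ⟨B, hB⟩ := exists_lintegral_fourier_regSymbol_le ha ha'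
  obtain ⟨K, hK, hKb⟩ := exists_bound_regSymbol (V := ℝ²) ha ha'
  refine ⟨B, fun v hv => ?_⟩
  let ε : ℕ → ℝ := fun n => 1 / ((n : ℝ) + 1)
  have hε (n : ℕ) : 0 < ε n := Nat.one_div_pos_of_nat
  have hε0 : Filter.Tendsto ε Filter.atTop (nhds 0) := tendsto_one_div_add_atTop_nhds_zero_nat
  have hsymb (ξ : ℝ²) : Filter.Tendsto (fun n => regSymbol (α / 2) (ε n) v ξ) Filter.atTop
      (nhds (inner ℝ v ξ * Real.exp (-‖ξ‖ ^ α))) := by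
    have hc : Continuous fun s : ℝ => regSymbol (α / 2) s v ξ := by
      unfold regSymbol
      have : Continuous fun s : ℝ => (s + ‖ξ‖ ^ 2) ^ (α / 2) :=
        (by fun_prop : Continuous fun s : ℝ => s + ‖ξ‖ ^ 2).rpow_const
          fun _ => Or.inr (by linarith)
      fun_prop
    have := (hc.tendsto 0).comp hε0
    convert! this using 2
    simp only [regSymbol, zero_add]
    rw [← Real.rpow_natCast, ← Real.rpow_mul (norm_nonneg _),
      show ((2 : ℕ) : ℝ) * (α / 2) = α by push_cast; ring]
  have hlim (x : ℝ²) : Filter.Tendsto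
      (fun n => ‖𝓕 (fun ξ : ℝ² => (regSymbol (α / 2) (ε n) v ξ : ℂ)) x‖ₑ) Filter.atTop
      (nhds ‖𝓕 (fun ξ : ℝ² => ((inner ℝ v ξ * Real.exp (-‖ξ‖ ^ α) : ℝ) : ℂ)) x‖ₑ) := by
    refine Filter.Tendsto.enorm ?_
    simp only [Real.fourier_eq]
    refine tendsto_integral_of_dominated_convergence
      (fun ξ : ℝ² => K * ((1 + ‖ξ‖ ^ 2) ^ 2)⁻¹) (fun n => ?_)
      (integrable_inv_one_add_norm_sq_sq.const_mul K)
      (fun n => Filter.Eventually.of_forall fun ξ => ?_)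
      (Filter.Eventually.of_forall fun ξ => ?_)
    · exact ((Real.fourierIntegral_convergent_iff x).2 (integrable_ofReal_of_bound
        (measurable_regSymbol _ _ v)
        fun ξ => (hKb (ε n) (hε n) v v hv hv ξ).1)).aestronglyMeasurable
    · rw [Circle.norm_smul, Complex.norm_real]
      exact (hKb (ε n) (hε n) v v hv hv ξ).1
    · exact ((Complex.continuous_ofReal.tendsto _).comp (hsymb ξ)).const_smul _
  calc _ = ∫⁻ x, Filter.liminf
        (fun n => ‖𝓕 (fun ξ : ℝ² => (regSymbol (α / 2) (ε n) v ξ : ℂ)) x‖ₑ) Filter.atTop :=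
        lintegral_congr fun x => (hlim x).liminf_eq.symm
    _ ≤ Filter.liminf (fun n => ∫⁻ x,
        ‖𝓕 (fun ξ : ℝ² => (regSymbol (α / 2) (ε n) v ξ : ℂ)) x‖ₑ) Filter.atTop := by
      refine lintegral_liminf_le fun n => ?_
      exact (continuous_fourier_of_integrable (integrable_ofReal_of_bound
        (measurable_regSymbol _ _ v)
        fun ξ => (hKb (ε n) (hε n) v v hv hv ξ).1)).measurable.enorm
    _ ≤ ENNReal.ofReal B := by
      refine (Filter.liminf_le_liminf
        (v := fun _ : ℕ => ENNReal.ofReal B)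
        (Filter.Eventually.of_forall fun n => hB (ε n) (hε n) v hv)).trans ?_
      simp

theorem norm_le_sum_norm_single (T : ℝ² →L[ℝ] ℂ) :
    ‖T‖ ≤ ‖T (EuclideanSpace.single 0 1)‖ + ‖T (EuclideanSpace.single 1 1)‖ := by
  refine T.opNorm_le_bound (by positivity) fun y => ?_
  have hy : y = y 0 • (EuclideanSpace.single 0 1 : ℝ²) +
      y 1 • (EuclideanSpace.single 1 1 : ℝ²) := by
    ext i
    fin_cases i <;> simp
  have h0 : ‖y 0‖ ≤ ‖y‖ := PiLp.norm_apply_le y 0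
  have h1 : ‖y 1‖ ≤ ‖y‖ := PiLp.norm_apply_le y 1
  calc ‖T y‖ = ‖y 0 • T (EuclideanSpace.single 0 1) + y 1 • T (EuclideanSpace.single 1 1)‖ := by
        conv_lhs => rw [hy]
        simp
    _ ≤ ‖y 0‖ * ‖T (EuclideanSpace.single 0 1)‖ + ‖y 1‖ * ‖T (EuclideanSpace.single 1 1)‖ := by
        refine (norm_add_le _ _).trans ?_
        rw [norm_smul, norm_smul]
    _ ≤ ‖y‖ * ‖T (EuclideanSpace.single 0 1)‖ + ‖y‖ * ‖T (EuclideanSpace.single 1 1)‖ := by gcongr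
    _ = _ := by ring

theorem lintegral_enorm_sub_translate_le {P : ℝ² → ℂ} (hP : Differentiable ℝ P)
    (hP' : Continuous (fderiv ℝ P)) (y : ℝ²) :
    ∫⁻ x, ‖P (x - y) - P x‖ₑ ≤ (∫⁻ x, ‖fderiv ℝ P x‖ₑ) * ‖y‖ₑ := by
  have hpt (x : ℝ²) : ‖P (x - y) - P x‖ₑ ≤
      ∫⁻ s in Set.Ioc (0 : ℝ) 1, ‖fderiv ℝ P (x - s • y)‖ₑ * ‖y‖ₑ := by
    have hd (s : ℝ) : HasDerivAt (fun s : ℝ => P (x - s • y)) (fderiv ℝ P (x - s • y) (-y)) s := by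
      have h1 : HasDerivAt (fun s : ℝ => x - s • y) (-y) s := by
        simpa using ((hasDerivAt_id s).smul_const y).const_sub x
      exact (hP _).hasFDerivAt.comp_hasDerivAt s h1
    have hcont : Continuous fun s : ℝ => fderiv ℝ P (x - s • y) (-y) :=
      (hP'.comp (by fun_prop)).clm_apply continuous_const
    have := intervalIntegral.integral_eq_sub_of_hasDerivAt (a := 0) (b := 1)
      (fun s _ => hd s) (hcont.intervalIntegrable _ _)
    rw [one_smul, zero_smul, sub_zero, intervalIntegral.integral_of_le zero_le_one] at this
    rw [← this]
    refine (enorm_integral_le_lintegral_enorm _).trans (lintegral_mono fun s => ?_)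
    refine (ContinuousLinearMap.le_opENorm _ _).trans ?_
    rw [enorm_neg]
  have hmeas : Measurable fun z : ℝ² × ℝ => ‖fderiv ℝ P (z.1 - z.2 • y)‖ₑ * ‖y‖ₑ :=
    ((hP'.comp (by fun_prop)).measurable.enorm).mul_const _
  calc _ ≤ ∫⁻ x, ∫⁻ s in Set.Ioc (0 : ℝ) 1, ‖fderiv ℝ P (x - s • y)‖ₑ * ‖y‖ₑ := lintegral_mono hpt
    _ = ∫⁻ s in Set.Ioc (0 : ℝ) 1, ∫⁻ x, ‖fderiv ℝ P (x - s • y)‖ₑ * ‖y‖ₑ :=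
      lintegral_lintegral_swap hmeas.aemeasurable
    _ = ∫⁻ _ in Set.Ioc (0 : ℝ) 1, (∫⁻ x, ‖fderiv ℝ P x‖ₑ) * ‖y‖ₑ := by
      refine lintegral_congr fun s => ?_
      rw [lintegral_mul_const' _ _ enorm_ne_top,
        lintegral_sub_right_eq_self (fun x => ‖fderiv ℝ P x‖ₑ) (s • y)]
    _ = _ := by simp

/-- Uniform, Lipschitz and `L¹`-translation bounds for the Fourier transform of `exp (-‖ξ‖ ^ α)`. -/
theorem exists_bound_fourier_exp {α : ℝ} (hα₁ : 1 ≤ α) (hα₂ : α ≤ 2) :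
    ∃ B : ℝ, 0 < B ∧ Continuous (𝓕 (fun ξ : ℝ² => (Real.exp (-‖ξ‖ ^ α) : ℂ))) ∧
      (∀ x, ‖𝓕 (fun ξ : ℝ² => (Real.exp (-‖ξ‖ ^ α) : ℂ)) x‖ ≤ B) ∧
      (∀ x y, ‖𝓕 (fun ξ : ℝ² => (Real.exp (-‖ξ‖ ^ α) : ℂ)) (x - y) -
        𝓕 (fun ξ : ℝ² => (Real.exp (-‖ξ‖ ^ α) : ℂ)) x‖ ≤ B * ‖y‖) ∧
      ∀ y, ∫⁻ x, ‖𝓕 (fun ξ : ℝ² => (Real.exp (-‖ξ‖ ^ α) : ℂ)) (x - y) -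
        𝓕 (fun ξ : ℝ² => (Real.exp (-‖ξ‖ ^ α) : ℂ)) x‖ₑ ≤ ENNReal.ofReal (B * ‖y‖) := by
  have ha : 1 / 2 ≤ α / 2 := by linarith
  obtain ⟨B, hB⟩ := exists_lintegral_fourier_symbol_le hα₁ hα₂
  obtain ⟨K, hK, hKb⟩ := exists_bound_mul_exp_neg_rpow (E := ℝ²) ha
  have hpow (ξ : ℝ²) : (0 + ‖ξ‖ ^ 2) ^ (α / 2) = ‖ξ‖ ^ α := by
    rw [zero_add, ← Real.rpow_natCast, ← Real.rpow_mul (norm_nonneg _),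
      show ((2 : ℕ) : ℝ) * (α / 2) = α by push_cast; ring]
  set h : ℝ² → ℂ := fun ξ => (Real.exp (-‖ξ‖ ^ α) : ℂ) with hh
  have hmeas : Measurable fun ξ : ℝ² => Real.exp (-‖ξ‖ ^ α) := by fun_prop
  have hn (ξ : ℝ²) : ‖h ξ‖ = Real.exp (-‖ξ‖ ^ α) := by
    rw [hh]; simp only [Complex.norm_real, Real.norm_eq_abs, Real.abs_exp]
  have h_int : Integrable h := by
    refine integrable_ofReal_of_bound (K := K) hmeas fun ξ => ?_
    have hb : |(1 : ℝ)| ≤ 14 * (1 + (0 + ‖ξ‖ ^ 2)) ^ 3 := by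
      have : 1 ≤ (1 + (0 + ‖ξ‖ ^ 2)) ^ 3 := one_le_pow₀ (by nlinarith [sq_nonneg ‖ξ‖])
      rw [abs_one]; linarith
    simpa only [hpow, one_mul] using hKb 0 le_rfl ξ 1 hb
  have hint1 : Integrable (fun ξ => ‖ξ‖ * ‖h ξ‖) := by
    refine Integrable.mono' (integrable_inv_one_add_norm_sq_sq.const_mul K) ?_
      (Filter.Eventually.of_forall fun ξ => ?_)
    · simp only [hn]
      fun_prop
    have hb : |‖ξ‖| ≤ 14 * (1 + (0 + ‖ξ‖ ^ 2)) ^ 3 := by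
      have h1 : 1 + (0 + ‖ξ‖ ^ 2) ≤ (1 + (0 + ‖ξ‖ ^ 2)) ^ 3 :=
        le_self_pow₀ (by nlinarith [sq_nonneg ‖ξ‖]) (by norm_num)
      rw [abs_norm]
      nlinarith [sq_nonneg (‖ξ‖ - 1)]
    simpa only [hpow, hn, Real.norm_eq_abs] using hKb 0 le_rfl ξ ‖ξ‖ hb
  have hsm : Integrable (VectorFourier.fourierSMulRight (innerSL ℝ) h) := by
    refine Integrable.mono' (hint1.const_mul (2 * π * ‖innerSL ℝ (E := ℝ²)‖))
      h_int.aestronglyMeasurable.fourierSMulRight (Filter.Eventually.of_forall fun ξ => ?_)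
    refine (VectorFourier.norm_fourierSMulRight_le _ _ _).trans_eq (by ring)
  have hdiff : Differentiable ℝ (𝓕 h) := Real.differentiable_fourier h_int hint1
  have hfd : fderiv ℝ (𝓕 h) = 𝓕 (VectorFourier.fourierSMulRight (innerSL ℝ) h) :=
    Real.fderiv_fourier h_int hint1
  have hcd : Continuous (fderiv ℝ (𝓕 h)) := by
    rw [hfd]; exact continuous_fourier_of_integrable hsm
  have hdir (e x : ℝ²) : ‖fderiv ℝ (𝓕 h) x e‖ₑ = ENNReal.ofReal (2 * π) *
      ‖𝓕 (fun ξ : ℝ² => ((inner ℝ e ξ * Real.exp (-‖ξ‖ ^ α) : ℝ) : ℂ)) x‖ₑ := by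
    have : fderiv ℝ (𝓕 h) x e = -(2 * π * Complex.I) *
        𝓕 (fun ξ : ℝ² => ((inner ℝ e ξ * Real.exp (-‖ξ‖ ^ α) : ℝ) : ℂ)) x := by
      rw [hfd, Real.fourier_continuousLinearMap_apply hsm]
      simp only [Real.fourier_eq]
      rw [← integral_const_mul]
      congr 1
      ext ξ
      rw [VectorFourier.fourierSMulRight_apply, innerSL_apply_apply, real_inner_comm e ξ]
      simp only [Circle.smul_def, smul_eq_mul, hh, Complex.real_smul]
      push_cast
      ring
    rw [this, enorm_mul]
    congr 1
    rw [← ofReal_norm]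
    simp [abs_of_pos Real.pi_pos]
  have hL1 : ∫⁻ x, ‖fderiv ℝ (𝓕 h) x‖ₑ ≤ ENNReal.ofReal (4 * π * B) := by
    set e₀ : ℝ² := EuclideanSpace.single 0 1
    set e₁ : ℝ² := EuclideanSpace.single 1 1
    have hle (x : ℝ²) : ‖fderiv ℝ (𝓕 h) x‖ₑ ≤
        ‖fderiv ℝ (𝓕 h) x e₀‖ₑ + ‖fderiv ℝ (𝓕 h) x e₁‖ₑ := by
      simp only [← ofReal_norm]
      rw [← ENNReal.ofReal_add (norm_nonneg _) (norm_nonneg _)]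
      exact ENNReal.ofReal_le_ofReal (norm_le_sum_norm_single _)
    have hdir' {e : ℝ²} (he : ‖e‖ = 1) :
        ∫⁻ x, ‖fderiv ℝ (𝓕 h) x e‖ₑ ≤ ENNReal.ofReal (2 * π * B) := by
      simp only [hdir]
      rw [lintegral_const_mul' _ _ ENNReal.ofReal_ne_top,
        ENNReal.ofReal_mul (p := 2 * π) (by positivity)]
      gcongr
      exact hB e he
    calc _ ≤ ∫⁻ x, (‖fderiv ℝ (𝓕 h) x e₀‖ₑ + ‖fderiv ℝ (𝓕 h) x e₁‖ₑ) := lintegral_mono hle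
      _ = (∫⁻ x, ‖fderiv ℝ (𝓕 h) x e₀‖ₑ) + ∫⁻ x, ‖fderiv ℝ (𝓕 h) x e₁‖ₑ :=
        lintegral_add_left (hcd.clm_apply continuous_const).measurable.enorm _
      _ ≤ ENNReal.ofReal (2 * π * B) + ENNReal.ofReal (2 * π * B) :=
        add_le_add (hdir' (by simp [e₀])) (hdir' (by simp [e₁]))
      _ = _ := by
        rw [← two_mul, show 4 * π * B = 2 * (2 * π * B) by ring, ENNReal.ofReal_mul zero_le_two]
        simp
  have hsup (x : ℝ²) : ‖fderiv ℝ (𝓕 h) x‖ ≤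
      ∫ ξ, ‖VectorFourier.fourierSMulRight (innerSL ℝ) h ξ‖ := by
    rw [hfd]; exact VectorFourier.norm_fourierIntegral_le_integral_norm _ _ _ _ _
  have hbd (x : ℝ²) : ‖𝓕 h x‖ ≤ ∫ ξ, ‖h ξ‖ :=
    VectorFourier.norm_fourierIntegral_le_integral_norm _ _ _ _ _
  set B₁ := ∫ ξ, ‖VectorFourier.fourierSMulRight (innerSL ℝ) h ξ‖
  set B₂ := ∫ ξ, ‖h ξ‖
  have hB₁ : 0 ≤ B₁ := integral_nonneg fun _ => norm_nonneg _
  have hB₂ : 0 ≤ B₂ := integral_nonneg fun _ => norm_nonneg _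
  have hB₀ : 4 * π * B ≤ |4 * π * B| := le_abs_self _
  have hB₀' : 0 ≤ |4 * π * B| := abs_nonneg _
  refine ⟨|4 * π * B| + B₁ + B₂ + 1, by positivity, continuous_fourier_of_integrable h_int,
    fun x => (hbd x).trans (by linarith), fun x y => ?_, fun y => ?_⟩
  · have := Convex.norm_image_sub_le_of_norm_fderiv_le (𝕜 := ℝ) (f := 𝓕 h) (s := Set.univ)
      (fun x _ => hdiff x) (fun x _ => hsup x) convex_univ (Set.mem_univ x) (Set.mem_univ (x - y))
    refine this.trans ?_
    rw [sub_sub_cancel_left, norm_neg]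
    gcongr
    linarith
  · refine (lintegral_enorm_sub_translate_le hdiff hcd y).trans ?_
    rw [ENNReal.ofReal_mul (by positivity), ofReal_norm]
    gcongr
    exact hL1.trans (ENNReal.ofReal_le_ofReal (by linarith))

theorem lintegral_comp_smul {E : Type*} [NormedAddCommGroup E] [NormedSpace ℝ E]
    [MeasurableSpace E] [BorelSpace E] [FiniteDimensional ℝ E] (μ : Measure E)
    [μ.IsAddHaarMeasure] {f : E → ℝ≥0∞} (hf : Measurable f) {r : ℝ} (hr : 0 < r) :
    ∫⁻ x, f (r • x) ∂μ = ENNReal.ofReal (r ^ Module.finrank ℝ E)⁻¹ * ∫⁻ x, f x ∂μ := by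
  have := lintegral_map (μ := μ) hf (measurable_const_smul r)
  rw [← this, Measure.map_addHaar_smul μ hr.ne', lintegral_smul_measure,
    abs_of_pos (by positivity), smul_eq_mul]

/-- `L^p` interpolation between `L^1` and `L^∞`, valid also for `p = ∞` since `∞.toReal = 0`. -/
theorem eLpNorm_le_of_bound_of_lintegral_le {X : Type*} [MeasurableSpace X] {μ : Measure X}
    {f : X → ℂ} {S L : ℝ} (hS : 0 ≤ S) (hL : 0 ≤ L) (hfS : ∀ x, ‖f x‖ ≤ S)
    (hfL : ∫⁻ x, ‖f x‖ₑ ∂μ ≤ ENNReal.ofReal L) {p : ℝ≥0∞} (hp : 1 ≤ p) :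
    eLpNorm f p μ ≤ ENNReal.ofReal (S ^ (1 - 1 / p.toReal) * L ^ (1 / p.toReal)) := by
  rcases eq_or_ne p ∞ with rfl | hp'
  · simpa using eLpNormEssSup_le_of_ae_bound (Filter.Eventually.of_forall hfS)
  have hp0 : p ≠ 0 := (zero_lt_one.trans_le hp).ne'
  have hr : 1 ≤ p.toReal := by
    simpa using ENNReal.toReal_mono hp' hp
  set r := p.toReal
  have hr0 : 0 < r := by linarith
  have hpt (x : X) : ‖f x‖ₑ ^ r ≤ ENNReal.ofReal (S ^ (r - 1)) * ‖f x‖ₑ := by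
    rw [← ofReal_norm, ENNReal.ofReal_rpow_of_nonneg (norm_nonneg _) hr0.le,
      ← ENNReal.ofReal_mul (by positivity)]
    apply ENNReal.ofReal_le_ofReal
    calc ‖f x‖ ^ r = ‖f x‖ ^ (r - 1 + 1) := by rw [sub_add_cancel]
      _ = ‖f x‖ ^ (r - 1) * ‖f x‖ := by
        rw [Real.rpow_add_of_nonneg (norm_nonneg _) (by linarith) zero_le_one, Real.rpow_one]
      _ ≤ S ^ (r - 1) * ‖f x‖ := by
        have : 0 ≤ r - 1 := by linarith
        gcongr
        exact hfS x
  rw [eLpNorm_eq_lintegral_rpow_enorm_toReal hp0 hp']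
  calc (∫⁻ x, ‖f x‖ₑ ^ r ∂μ) ^ (1 / r)
      ≤ (ENNReal.ofReal (S ^ (r - 1)) * ENNReal.ofReal L) ^ (1 / r) := by
        gcongr
        refine (lintegral_mono hpt).trans ?_
        rw [lintegral_const_mul' _ _ ENNReal.ofReal_ne_top]
        gcongr
    _ = _ := by
        rw [← ENNReal.ofReal_mul (by positivity),
          ENNReal.ofReal_rpow_of_nonneg (by positivity) (by positivity),
          Real.mul_rpow (by positivity) hL, ← Real.rpow_mul hS]
        congr 3
        field_simp

theorem eLpNorm_convolution_sub_integral_mul_le {P : ℝ² → ℂ} {K S L : ℝ} (hP : Continuous P)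
    (hK : ∀ x, ‖P x‖ ≤ K) (hS : 0 ≤ S) (hL : 0 ≤ L)
    (hPS : ∀ x y, ‖P (x - y) - P x‖ ≤ S * ‖y‖)
    (hPL : ∀ y, ∫⁻ x, ‖P (x - y) - P x‖ₑ ≤ ENNReal.ofReal (L * ‖y‖))
    {φ : ℝ² → ℝ} (hφ : Integrable φ) (hφ1 : Integrable fun x => ‖x‖ * |φ x|)
    {p : ℝ≥0∞} (hp : 1 ≤ p) :
    eLpNorm (fun x => (∫ y, P (x - y) * (φ y : ℂ)) - ((∫ y, φ y : ℝ) : ℂ) * P x) p volume ≤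
      ENNReal.ofReal (S ^ (1 - 1 / p.toReal) * L ^ (1 / p.toReal) * ∫ x, ‖x‖ * |φ x|) := by
  have hm : 0 ≤ ∫ x, ‖x‖ * |φ x| := integral_nonneg fun x => by positivity
  have heq (x : ℝ²) : (∫ y, P (x - y) * (φ y : ℂ)) - ((∫ y, φ y : ℝ) : ℂ) * P x =
      ∫ y, (P (x - y) - P x) * (φ y : ℂ) := by
    have h1 : Integrable fun y => P (x - y) * (φ y : ℂ) :=
      hφ.ofReal.bdd_mul (hP.comp (by fun_prop)).aestronglyMeasurable
        (Filter.Eventually.of_forall fun y => hK (x - y))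
    have h2 : Integrable fun y => P x * (φ y : ℂ) := hφ.ofReal.const_mul _
    simp only [sub_mul]
    rw [integral_sub h1 h2, integral_const_mul, integral_complex_ofReal, mul_comm (P x)]
  simp only [heq]
  refine (eLpNorm_le_of_bound_of_lintegral_le (S := S * ∫ x, ‖x‖ * |φ x|)
    (L := L * ∫ x, ‖x‖ * |φ x|) (by positivity) (by positivity) (fun x => ?_) ?_ hp).trans_eq ?_
  · rw [← integral_const_mul]
    refine norm_integral_le_of_norm_le (hφ1.const_mul S) (Filter.Eventually.of_forall fun y => ?_)
    rw [norm_mul, Complex.norm_real, Real.norm_eq_abs, ← mul_assoc]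
    gcongr
    exact hPS x y
  · have hmeas : AEMeasurable
        (fun z : ℝ² × ℝ² => ‖P (z.1 - z.2) - P z.1‖ₑ * ‖φ z.2‖ₑ) (volume.prod volume) := by
      have : Continuous fun z : ℝ² × ℝ² => P (z.1 - z.2) - P z.1 := by fun_prop
      exact this.measurable.enorm.aemeasurable.mul hφ.aestronglyMeasurable.enorm.comp_snd
    calc ∫⁻ x, ‖∫ y, (P (x - y) - P x) * (φ y : ℂ)‖ₑ
        ≤ ∫⁻ x, ∫⁻ y, ‖P (x - y) - P x‖ₑ * ‖φ y‖ₑ := by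
          refine lintegral_mono fun x => (enorm_integral_le_lintegral_enorm _).trans_eq ?_
          refine lintegral_congr fun y => ?_
          rw [enorm_mul, ← ofReal_norm (φ y : ℂ), Complex.norm_real, ofReal_norm]
      _ = ∫⁻ y, ∫⁻ x, ‖P (x - y) - P x‖ₑ * ‖φ y‖ₑ := lintegral_lintegral_swap hmeas
      _ ≤ ∫⁻ y, ENNReal.ofReal (L * (‖y‖ * |φ y|)) := by
          refine lintegral_mono fun y => ?_
          rw [lintegral_mul_const' _ _ enorm_ne_top, ← mul_assoc,
            ENNReal.ofReal_mul (by positivity), ← Real.norm_eq_abs, ofReal_norm]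
          gcongr
          exact hPL y
      _ = _ := by
          rw [← integral_const_mul, ofReal_integral_eq_lintegral_ofReal (hφ1.const_mul L)
            (Filter.Eventually.of_forall fun y => by positivity)]
  · congr 1
    rw [Real.mul_rpow hS hm, Real.mul_rpow hL hm, mul_mul_mul_comm,
      ← Real.rpow_add' hm (by simp)]
    simp

theorem fracHeatKernel_eq {α t : ℝ} (hα : 0 < α) (ht : 0 < t) (x : ℝ²) :
    fracHeatKernel α t x = (((t ^ (-(1 / α))) ^ 2 : ℝ) : ℂ) *
      𝓕 (fun ξ : ℝ² => (Real.exp (-‖ξ‖ ^ α) : ℂ)) (t ^ (-(1 / α)) • x) := by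
  have hc : 0 < t ^ (1 / α) := by positivity
  have hcinv : t ^ (-(1 / α)) = (t ^ (1 / α))⁻¹ := Real.rpow_neg ht.le _
  have hsc (ξ : ℝ²) : -t * ‖ξ‖ ^ α = -‖t ^ (1 / α) • ξ‖ ^ α := by
    rw [norm_smul, Real.norm_of_nonneg hc.le, Real.mul_rpow hc.le (norm_nonneg _),
      ← Real.rpow_mul ht.le, one_div_mul_cancel hα.ne', Real.rpow_one, neg_mul]
  rw [fracHeatKernel, Real.fourierInv_eq_fourier_neg, Real.fourier_eq, Real.fourier_eq]
  have key := Measure.integral_comp_smul (volume : Measure ℝ²) (fun ξ : ℝ² =>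
    Real.fourierChar (-(inner ℝ ξ (t ^ (-(1 / α)) • x))) • (Real.exp (-‖ξ‖ ^ α) : ℂ))
    (-t ^ (1 / α))
  rw [finrank_euclideanSpace_fin, neg_sq, abs_of_pos (by positivity), ← inv_pow, ← hcinv,
    Complex.real_smul] at key
  rw [← key]
  congr 1
  ext ξ
  rw [hsc, inner_smul_left, inner_smul_right, hcinv, neg_smul, norm_neg, inner_neg_right]
  congr 3
  simp only [conj_trivial]
  field_simp

theorem fracHeatKernel_bounds {α : ℝ} (hα₁ : 1 ≤ α) (hα₂ : α ≤ 2) :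
    ∃ B : ℝ, 0 < B ∧ ∀ t : ℝ, 0 < t → Continuous (fracHeatKernel α t) ∧
      (∃ K, ∀ x, ‖fracHeatKernel α t x‖ ≤ K) ∧
      (∀ x y, ‖fracHeatKernel α t (x - y) - fracHeatKernel α t x‖ ≤
        B * (t ^ (-(1 / α))) ^ 3 * ‖y‖) ∧
      ∀ y, ∫⁻ x, ‖fracHeatKernel α t (x - y) - fracHeatKernel α t x‖ₑ ≤
        ENNReal.ofReal (B * t ^ (-(1 / α)) * ‖y‖) := by
  obtain ⟨B, hB, hcont, hbd, hsup, h_int⟩ := exists_bound_fourier_exp hα₁ hα₂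
  have heq (t : ℝ) (ht : 0 < t) := funext (fracHeatKernel_eq (zero_lt_one.trans_le hα₁) ht)
  set P := 𝓕 (fun ξ : ℝ² => (Real.exp (-‖ξ‖ ^ α) : ℂ))
  refine ⟨B, hB, fun t ht => ?_⟩
  rw [heq t ht]
  have hc : 0 < t ^ (-(1 / α)) := by positivity
  set c := t ^ (-(1 / α))
  have hnorm (z : ℂ) : ‖((c ^ 2 : ℝ) : ℂ) * z‖ = c ^ 2 * ‖z‖ := by
    rw [norm_mul, Complex.norm_real, Real.norm_of_nonneg (by positivity)]
  have henorm (z : ℂ) : ‖((c ^ 2 : ℝ) : ℂ) * z‖ₑ = ENNReal.ofReal (c ^ 2) * ‖z‖ₑ := by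
    rw [← ofReal_norm, hnorm, ENNReal.ofReal_mul (by positivity), ofReal_norm]
  refine ⟨by fun_prop, ⟨c ^ 2 * B, fun x => ?_⟩, fun x y => ?_, fun y => ?_⟩
  · rw [hnorm]
    gcongr
    exact hbd _
  · rw [← mul_sub, hnorm, smul_sub]
    calc _ ≤ c ^ 2 * (B * ‖c • y‖) := by gcongr; exact hsup _ _
      _ = _ := by rw [norm_smul, Real.norm_of_nonneg hc.le]; ring
  · simp only [← mul_sub, henorm, smul_sub]
    have hm : Measurable fun x : ℝ² => ‖P (x - c • y) - P x‖ₑ :=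
      (by fun_prop : Continuous fun x : ℝ² => P (x - c • y) - P x).measurable.enorm
    rw [lintegral_const_mul' _ _ ENNReal.ofReal_ne_top, lintegral_comp_smul volume hm hc,
      ← mul_assoc, ← ENNReal.ofReal_mul (by positivity), finrank_euclideanSpace_fin,
      mul_inv_cancel₀ (by positivity), ENNReal.ofReal_one, one_mul]
    refine (h_int _).trans_eq ?_
    rw [norm_smul, Real.norm_of_nonneg hc.le, mul_assoc]

end Gradient

/-- first-order approximation of the linear evolution by the kernel:
`‖P_{α/2}(t) ∗ φ − M P_{α/2}(t)‖_{L^p} ≤ C ‖φ‖_{L¹(|x|dx)} t^{-(2/α)(1-1/p) - 1/α}`. -/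
theorem linear_part_first_order_approx (α : ℝ) (hα₁ : 1 ≤ α) (hα₂ : α ≤ 2)
    (p : ℝ≥0∞) (hp : 1 ≤ p)
    (φ : EuclideanSpace ℝ (Fin 2) → ℝ)
    (hφ : Integrable φ)
    (hφ1 : Integrable (fun x : EuclideanSpace ℝ (Fin 2) => ‖x‖ * |φ x|)) :
    ∃ C > 0, ∀ t : ℝ, 0 < t →
      eLpNorm
        (fun x : EuclideanSpace ℝ (Fin 2) =>
          (∫ y, fracHeatKernel α t (x - y) * (φ y : ℂ)) -
            ((∫ y, φ y : ℝ) : ℂ) * fracHeatKernel α t x) p volume ≤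
      ENNReal.ofReal
        (C * (∫ x : EuclideanSpace ℝ (Fin 2), ‖x‖ * |φ x|) *
          t ^ (-(2 / α) * (1 - 1 / p.toReal) - 1 / α)) := by
  obtain ⟨B, hB, h⟩ := fracHeatKernel_bounds hα₁ hα₂
  refine ⟨B, hB, fun t ht => ?_⟩
  obtain ⟨hcont, ⟨K, hK⟩, hsup, h_int⟩ := h t ht
  refine (eLpNorm_convolution_sub_integral_mul_le hcont hK (by positivity) (by positivity)
    hsup h_int hφ hφ1 hp).trans_eq ?_
  congr 1
  set θ := 1 / p.toReal
  rw [Real.mul_rpow hB.le (by positivity), Real.mul_rpow hB.le (by positivity), mul_mul_mul_comm,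
    ← Real.rpow_add hB, sub_add_cancel, Real.rpow_one, ← Real.rpow_natCast,
    ← Real.rpow_mul ht.le, ← Real.rpow_mul ht.le, ← Real.rpow_mul ht.le, ← Real.rpow_add ht,
    mul_right_comm]
  congr 2
  push_cast
  ring
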